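/- arXiv:2509.21700 — 3 statements merged into one kernel-verified Lean document; each statement's English description precedes it below -/
import Mathlib

section
/- Each of the three bone boundary words evaluates to the identity matrix: (γ⁻¹·β⁻¹)³·α⁻¹·(γ·β)³·α = I, γ⁻¹·(β⁻¹·α⁻¹)³·γ·(β·α)³ = I, and β⁻¹·(α⁻¹·γ)³·β·(α·γ⁻¹)³ = I. -/
open Matrix

/-- `ω = exp(2πi/12)`, a primitive 12th root of unity. -/
noncomputable def ω : ℂ := Complex.exp (2 * Real.pi * Complex.I / 12)

/-- The SL₂(ℂ) connection matrix on northeast edges. -/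
noncomputable def α : Matrix (Fin 2) (Fin 2) ℂ := !![ω^7, 0; 0, ω^5]

/-- The SL₂(ℂ) connection matrix on northwest edges. -/
noncomputable def β : Matrix (Fin 2) (Fin 2) ℂ := !![ω^7, ω^3; 0, ω^5]

/-- The SL₂(ℂ) connection matrix on horizontal edges. -/
noncomputable def γ : Matrix (Fin 2) (Fin 2) ℂ := !![ω^5, 0; ω^3, ω^7]

theorem omega_isPrimitiveRoot : IsPrimitiveRoot ω 12 := by
  simpa [ω] using Complex.isPrimitiveRoot_exp 12 (by norm_num)

theorem omega_pow_four : ω ^ 4 = ω ^ 2 - 1 := by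
  have h12 : ω ^ 12 = 1 := omega_isPrimitiveRoot.pow_eq_one
  have h6 : ω ^ 6 - 1 ≠ 0 :=
    sub_ne_zero.mpr (omega_isPrimitiveRoot.pow_ne_one_of_pos_of_lt (by norm_num) (by norm_num))
  have h4 : ω ^ 4 - 1 ≠ 0 :=
    sub_ne_zero.mpr (omega_isPrimitiveRoot.pow_ne_one_of_pos_of_lt (by norm_num) (by norm_num))
  refine mul_left_cancel₀ (mul_ne_zero h6 h4) ?_
  linear_combination (ω ^ 2 - 1) * h12

theorem omega_pow_ten : ω ^ 10 = 1 - ω ^ 2 := by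
  linear_combination (ω ^ 6 + ω ^ 4 - 1) * omega_pow_four

theorem omega_pow_fourteen : ω ^ 14 = ω ^ 2 := by
  linear_combination ω ^ 2 * omega_isPrimitiveRoot.pow_eq_one

theorem Matrix.pow_three_eq_neg_one_of_det_eq_one_of_trace_eq_one {R : Type*} [CommRing R]
    {A : Matrix (Fin 2) (Fin 2) R} (hdet : A.det = 1) (htrace : A.trace = 1) : A ^ 3 = -1 := by
  nontriviality R
  have h := A.aeval_self_charpoly
  simp only [charpoly_fin_two, hdet, htrace, map_add, map_sub, map_pow, map_one,
    Polynomial.aeval_X, one_mul] at h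
  calc A ^ 3 = (A + 1) * (A ^ 2 - A + 1) - 1 := by noncomm_ring
    _ = -1 := by rw [h, mul_zero, zero_sub]

theorem alpha_det : α.det = 1 := by
  simp [α, det_fin_two_of, ← pow_add, omega_isPrimitiveRoot.pow_eq_one]

theorem beta_det : β.det = 1 := by
  simp [β, det_fin_two_of, ← pow_add, omega_isPrimitiveRoot.pow_eq_one]

theorem gamma_det : γ.det = 1 := by
  simp [γ, det_fin_two_of, ← pow_add, omega_isPrimitiveRoot.pow_eq_one]

theorem alpha_inv : α⁻¹ = !![ω ^ 5, 0; 0, ω ^ 7] := by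
  rw [inv_def, alpha_det, Ring.inverse_one, one_smul, α, adjugate_fin_two_of]
  simp

theorem beta_inv : β⁻¹ = !![ω ^ 5, -ω ^ 3; 0, ω ^ 7] := by
  rw [inv_def, beta_det, Ring.inverse_one, one_smul, β, adjugate_fin_two_of]
  simp

theorem gamma_inv : γ⁻¹ = !![ω ^ 7, 0; -ω ^ 3, ω ^ 5] := by
  rw [inv_def, gamma_det, Ring.inverse_one, one_smul, γ, adjugate_fin_two_of]
  simp

/-- Each of the three bone boundary words evaluates to the identity matrix. -/
theorem bone_boundary_words_eq_one :
    (γ⁻¹ * β⁻¹)^3 * α⁻¹ * (γ * β)^3 * α = (1 : Matrix (Fin 2) (Fin 2) ℂ) ∧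
    γ⁻¹ * (β⁻¹ * α⁻¹)^3 * γ * (β * α)^3 = (1 : Matrix (Fin 2) (Fin 2) ℂ) ∧
    β⁻¹ * (α⁻¹ * γ)^3 * β * (α * γ⁻¹)^3 = (1 : Matrix (Fin 2) (Fin 2) ℂ) := by
  have cube {A : Matrix (Fin 2) (Fin 2) ℂ} (hd : A.det = 1) (ht : A.trace = 1) : A ^ 3 = -1 :=
    pow_three_eq_neg_one_of_det_eq_one_of_trace_eq_one hd ht
  have h12 : ω ^ 12 = 1 := omega_isPrimitiveRoot.pow_eq_one
  have h₁ : (γ⁻¹ * β⁻¹) ^ 3 = -1 := cube (by simp [gamma_det, beta_det]) <| by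
    simp only [gamma_inv, beta_inv, mul_fin_two, trace_fin_two_of]
    linear_combination (2 : ℂ) * h12 + (ω ^ 2 + 1) * omega_pow_four
  have h₂ : (γ * β) ^ 3 = -1 := cube (by simp [gamma_det, beta_det]) <| by
    simp only [γ, β, mul_fin_two, trace_fin_two_of]
    linear_combination (2 : ℂ) * h12 + (ω ^ 2 + 1) * omega_pow_four
  have h₃ : (β⁻¹ * α⁻¹) ^ 3 = -1 := cube (by simp [alpha_det, beta_det]) <| by
    simp only [beta_inv, alpha_inv, mul_fin_two, trace_fin_two_of]
    linear_combination omega_pow_ten + omega_pow_fourteen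
  have h₄ : (β * α) ^ 3 = -1 := cube (by simp [alpha_det, beta_det]) <| by
    simp only [β, α, mul_fin_two, trace_fin_two_of]
    linear_combination omega_pow_ten + omega_pow_fourteen
  have h₅ : (α⁻¹ * γ) ^ 3 = -1 := cube (by simp [alpha_det, gamma_det]) <| by
    simp only [alpha_inv, γ, mul_fin_two, trace_fin_two_of]
    linear_combination omega_pow_ten + omega_pow_fourteen
  have h₆ : (α * γ⁻¹) ^ 3 = -1 := cube (by simp [alpha_det, gamma_det]) <| by
    simp only [gamma_inv, α, mul_fin_two, trace_fin_two_of]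
    linear_combination omega_pow_ten + omega_pow_fourteen
  rw [h₁, h₂, h₃, h₄, h₅, h₆]
  simp [nonsing_inv_mul, alpha_det, beta_det, gamma_det]
end

section
/- The six snake boundary words in the letters X, Y, Z evaluate to the identity matrix: N₁ = Z·y·Z·Z·Y·z·Y·z·X = I, N₂ = Z·x·Z·x·Y·X·z·X·X = I, N₃ = y·Z·y·Z·Y·Y·z·Y·X = I, N₄ = Z·Z·x·Z·Y·z·X·z·X = I, N₅ = Z·x·Y·x·Y·X·X·y·X = I, and N₆ = y·Z·Y·x·Y·Y·X·y·X = I. -/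
open Matrix

/-- The length-two move `X = β·α`. -/
noncomputable def X : Matrix (Fin 2) (Fin 2) ℂ := β * α

/-- The length-two move `Y = α⁻¹·γ`. -/
noncomputable def Y : Matrix (Fin 2) (Fin 2) ℂ := α⁻¹ * γ

/-- The length-two move `Z = γ⁻¹·β⁻¹`. -/
noncomputable def Z : Matrix (Fin 2) (Fin 2) ℂ := γ⁻¹ * β⁻¹

/-- `x = X⁻¹`. -/
noncomputable def x : Matrix (Fin 2) (Fin 2) ℂ := X⁻¹

/-- `y = Y⁻¹`. -/
noncomputable def y : Matrix (Fin 2) (Fin 2) ℂ := Y⁻¹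

/-- `z = Z⁻¹`. -/
noncomputable def z : Matrix (Fin 2) (Fin 2) ℂ := Z⁻¹

theorem omega_pow_six : ω ^ 6 = -1 := by
  linear_combination (ω ^ 2 + 1) * omega_pow_four

theorem omega_pow_twelve : ω ^ 12 = 1 := by
  linear_combination (ω ^ 6 - 1) * omega_pow_six

/-- The inverse of a `2 × 2` matrix of determinant one is its adjugate. -/
theorem inv_fin_two_of_det_eq_one {a b c d : ℂ} (h : a * d - b * c = 1) :
    (!![a, b; c, d])⁻¹ = !![d, -b; -c, a] := by
  simp [Matrix.inv_def, Matrix.det_fin_two_of, Matrix.adjugate_fin_two_of, h]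

theorem X_eq : X = !![ω ^ 2, -ω ^ 2; 0, 1 - ω ^ 2] := by
  have h := omega_pow_four
  ext i j
  fin_cases i <;> fin_cases j <;> simp [X, α, β] <;> grind

theorem Y_eq : Y = !![1 - ω ^ 2, 0; 1 - ω ^ 2, ω ^ 2] := by
  have h := omega_pow_four
  ext i j
  fin_cases i <;> fin_cases j <;> simp [Y, alpha_inv, γ] <;> grind

theorem Z_eq : Z = !![1, ω ^ 2 - 1; ω ^ 2, 0] := by
  have h := omega_pow_four
  ext i j
  fin_cases i <;> fin_cases j <;> simp [Z, gamma_inv, beta_inv] <;> grind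

theorem x_eq : x = !![1 - ω ^ 2, ω ^ 2; 0, ω ^ 2] := by
  rw [x, X_eq, inv_fin_two_of_det_eq_one (by linear_combination -omega_pow_four)]
  simp

theorem y_eq : y = !![ω ^ 2, 0; ω ^ 2 - 1, 1 - ω ^ 2] := by
  rw [y, Y_eq, inv_fin_two_of_det_eq_one (by linear_combination -omega_pow_four)]
  simp

theorem z_eq : z = !![0, 1 - ω ^ 2; -ω ^ 2, 1] := by
  rw [z, Z_eq, inv_fin_two_of_det_eq_one (by linear_combination -omega_pow_four)]
  simp

/-- The six snake boundary words in the letters X, Y, Z evaluate to the identity matrix. -/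
theorem snake_words_XYZ_eq_one :
    Z * y * Z * Z * Y * z * Y * z * X = (1 : Matrix (Fin 2) (Fin 2) ℂ) ∧
    Z * x * Z * x * Y * X * z * X * X = (1 : Matrix (Fin 2) (Fin 2) ℂ) ∧
    y * Z * y * Z * Y * Y * z * Y * X = (1 : Matrix (Fin 2) (Fin 2) ℂ) ∧
    Z * Z * x * Z * Y * z * X * z * X = (1 : Matrix (Fin 2) (Fin 2) ℂ) ∧
    Z * x * Y * x * Y * X * X * y * X = (1 : Matrix (Fin 2) (Fin 2) ℂ) ∧
    y * Z * Y * x * Y * Y * X * y * X = (1 : Matrix (Fin 2) (Fin 2) ℂ) := by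
  have h := omega_pow_four
  rw [X_eq, Y_eq, Z_eq, x_eq, y_eq, z_eq, Matrix.one_fin_two]
  simp only [Matrix.mul_fin_two]
  refine ⟨?_, ?_, ?_, ?_, ?_, ?_⟩ <;> congr! 3 <;> grind
end

section
/- Algebraic form of the bones-and-snakes corollary: let n ≥ 0, let g₁, …, gₙ each be an arbitrary product of the matrices α, β, γ and their inverses, and let T₁, …, Tₙ each be one of the nine bone or snake boundary matrices B₁, B₂, B₃, N₁, …, N₆ or an inverse of one of them. Then the product (g₁·T₁·g₁⁻¹)·(g₂·T₂·g₂⁻¹)·⋯·(gₙ·Tₙ·gₙ⁻¹) equals I. Consequently the smallest normal subgroup of ⟨α, β, γ⟩ containing the bone and snake boundary matrices is trivial, so if a region R has a signed tiling using only bones and snakes, the connection-matrix product along ∂R is I. -/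
open Matrix

/-- Bone boundary word `B₁ = Z·Z·Z·Y·z·z·X`. -/
noncomputable def B₁ : Matrix (Fin 2) (Fin 2) ℂ := Z * Z * Z * Y * z * z * X

/-- Bone boundary word `B₂ = Z·x·x·Y·X·X·X`. -/
noncomputable def B₂ : Matrix (Fin 2) (Fin 2) ℂ := Z * x * x * Y * X * X * X

/-- Bone boundary word `B₃ = Z·Y·Y·Y·X·y·y`. -/
noncomputable def B₃ : Matrix (Fin 2) (Fin 2) ℂ := Z * Y * Y * Y * X * y * y

/-- Stone boundary word `S₁ = Z·Z·Y·Y·X·X`. -/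
noncomputable def S₁ : Matrix (Fin 2) (Fin 2) ℂ := Z * Z * Y * Y * X * X

/-- Stone boundary word `S₂ = y·Z·x·Y·z·X`. -/
noncomputable def S₂ : Matrix (Fin 2) (Fin 2) ℂ := y * Z * x * Y * z * X

/-- Snake boundary word `N₁ = Z·y·Z·Z·Y·z·Y·z·X`. -/
noncomputable def N₁ : Matrix (Fin 2) (Fin 2) ℂ := Z * y * Z * Z * Y * z * Y * z * X

/-- Snake boundary word `N₂ = Z·x·Z·x·Y·X·z·X·X`. -/
noncomputable def N₂ : Matrix (Fin 2) (Fin 2) ℂ := Z * x * Z * x * Y * X * z * X * X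

/-- Snake boundary word `N₃ = y·Z·y·Z·Y·Y·z·Y·X`. -/
noncomputable def N₃ : Matrix (Fin 2) (Fin 2) ℂ := y * Z * y * Z * Y * Y * z * Y * X

/-- Snake boundary word `N₄ = Z·Z·x·Z·Y·z·X·z·X`. -/
noncomputable def N₄ : Matrix (Fin 2) (Fin 2) ℂ := Z * Z * x * Z * Y * z * X * z * X

/-- Snake boundary word `N₅ = Z·x·Y·x·Y·X·X·y·X`. -/
noncomputable def N₅ : Matrix (Fin 2) (Fin 2) ℂ := Z * x * Y * x * Y * X * X * y * X

/-- Snake boundary word `N₆ = y·Z·Y·x·Y·Y·X·y·X`. -/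
noncomputable def N₆ : Matrix (Fin 2) (Fin 2) ℂ := y * Z * Y * x * Y * Y * X * y * X

/-- The eleven tile boundary matrices: three bones, two stones, six snakes. -/
noncomputable def tileBoundaries : Set (Matrix (Fin 2) (Fin 2) ℂ) :=
  {B₁, B₂, B₃, S₁, S₂, N₁, N₂, N₃, N₄, N₅, N₆}

/-- The nine bone and snake boundary matrices. -/
noncomputable def boneSnakeBoundaries : Set (Matrix (Fin 2) (Fin 2) ℂ) :=
  {B₁, B₂, B₃, N₁, N₂, N₃, N₄, N₅, N₆}

theorem inv_of_det_eq_one (a b c d : ℂ) (h : a * d - b * c = 1) :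
    (!![a, b; c, d])⁻¹ = !![d, -b; -c, a] := by
  rw [Matrix.inv_def, Matrix.det_fin_two_of, h, Matrix.adjugate_fin_two_of]
  simp

theorem B₁_eq_one : B₁ = 1 := by
  have h := omega_pow_four
  simp only [B₁, X_eq, Y_eq, Z_eq, z_eq, Matrix.mul_fin_two, Matrix.one_fin_two]
  congr! 3 <;> grind

theorem B₂_eq_one : B₂ = 1 := by
  have h := omega_pow_four
  simp only [B₂, X_eq, Y_eq, Z_eq, x_eq, Matrix.mul_fin_two, Matrix.one_fin_two]
  congr! 3 <;> grind

theorem B₃_eq_one : B₃ = 1 := by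
  have h := omega_pow_four
  simp only [B₃, X_eq, Y_eq, Z_eq, y_eq, Matrix.mul_fin_two, Matrix.one_fin_two]
  congr! 3 <;> grind

theorem N₁_eq_one : N₁ = 1 := by
  have h := omega_pow_four
  simp only [N₁, X_eq, Y_eq, Z_eq, y_eq, z_eq, Matrix.mul_fin_two, Matrix.one_fin_two]
  congr! 3 <;> grind

theorem N₂_eq_one : N₂ = 1 := by
  have h := omega_pow_four
  simp only [N₂, X_eq, Y_eq, Z_eq, x_eq, z_eq, Matrix.mul_fin_two, Matrix.one_fin_two]
  congr! 3 <;> grind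

theorem N₃_eq_one : N₃ = 1 := by
  have h := omega_pow_four
  simp only [N₃, X_eq, Y_eq, Z_eq, y_eq, z_eq, Matrix.mul_fin_two, Matrix.one_fin_two]
  congr! 3 <;> grind

theorem N₄_eq_one : N₄ = 1 := by
  have h := omega_pow_four
  simp only [N₄, X_eq, Y_eq, Z_eq, x_eq, z_eq, Matrix.mul_fin_two, Matrix.one_fin_two]
  congr! 3 <;> grind

theorem N₅_eq_one : N₅ = 1 := by
  have h := omega_pow_four
  simp only [N₅, X_eq, Y_eq, Z_eq, x_eq, y_eq, Matrix.mul_fin_two, Matrix.one_fin_two]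
  congr! 3 <;> grind

theorem N₆_eq_one : N₆ = 1 := by
  have h := omega_pow_four
  simp only [N₆, X_eq, Y_eq, Z_eq, x_eq, y_eq, Matrix.mul_fin_two, Matrix.one_fin_two]
  congr! 3 <;> grind

theorem eq_one_of_mem_boneSnakeBoundaries {t : Matrix (Fin 2) (Fin 2) ℂ}
    (ht : t ∈ boneSnakeBoundaries) : t = 1 := by
  rcases ht with rfl | rfl | rfl | rfl | rfl | rfl | rfl | rfl | rfl
  · exact B₁_eq_one
  · exact B₂_eq_one
  · exact B₃_eq_one
  · exact N₁_eq_one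
  · exact N₂_eq_one
  · exact N₃_eq_one
  · exact N₄_eq_one
  · exact N₅_eq_one
  · exact N₆_eq_one

theorem isUnit_det_of_mem_closure {g : Matrix (Fin 2) (Fin 2) ℂ}
    (hg : g ∈ Submonoid.closure
      ({α, β, γ, α⁻¹, β⁻¹, γ⁻¹} : Set (Matrix (Fin 2) (Fin 2) ℂ))) : IsUnit g.det := by
  have h := omega_pow_four
  induction hg using Submonoid.closure_induction with
  | mem m hm =>
    have hdet : m.det = 1 := by
      rcases hm with rfl | rfl | rfl | rfl | rfl | rfl
      · rw [α, Matrix.det_fin_two_of]; grind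
      · rw [β, Matrix.det_fin_two_of]; grind
      · rw [γ, Matrix.det_fin_two_of]; grind
      · rw [alpha_inv, Matrix.det_fin_two_of]; grind
      · rw [beta_inv, Matrix.det_fin_two_of]; grind
      · rw [gamma_inv, Matrix.det_fin_two_of]; grind
    rw [hdet]
    exact isUnit_one
  | one => simp
  | mul a b _ _ ha hb =>
    rw [Matrix.det_mul]
    exact ha.mul hb

/-- Bones-and-snakes corollary, algebraic form: any product of conjugates (by words in
α, β, γ and their inverses) of bone or snake boundary matrices or their inverses is `I`. -/
theorem bones_snakes_boundary_eq_one (n : ℕ)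
    (g T : Fin n → Matrix (Fin 2) (Fin 2) ℂ)
    (hg : ∀ i, g i ∈ Submonoid.closure
      ({α, β, γ, α⁻¹, β⁻¹, γ⁻¹} : Set (Matrix (Fin 2) (Fin 2) ℂ)))
    (hT : ∀ i, T i ∈ boneSnakeBoundaries ∨ ∃ t ∈ boneSnakeBoundaries, T i = t⁻¹) :
    (List.ofFn fun i => g i * T i * (g i)⁻¹).prod = (1 : Matrix (Fin 2) (Fin 2) ℂ) := by
  refine List.prod_eq_one fun m hm => ?_
  obtain ⟨i, rfl⟩ := (List.mem_ofFn' _ _).mp hm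
  have hTi : T i = 1 := by
    rcases hT i with h | ⟨t, ht, h⟩
    · exact eq_one_of_mem_boneSnakeBoundaries h
    · rw [h, eq_one_of_mem_boneSnakeBoundaries ht, inv_one]
  simp only [hTi, mul_one]
  exact Matrix.mul_nonsing_inv _ (isUnit_det_of_mem_closure (hg i))
end
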